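/- arXiv:alg-geom/9711022 — 5 statements merged into one kernel-verified Lean document; each statement's English description precedes it below -/
import Mathlib

section
/- Let A be a nonzero commutative ring whose nilradical is a prime ideal (equivalently, Spec A is irreducible). A formal Laurent series f = Σ_i a_i z^i ∈ A((z)) is a unit of A((z)) if and only if there exists an integer n such that a_n is a unit of A and a_i is nilpotent for every i < n. -/
/-- A Laurent series whose coefficients are nilpotent below some index and zero from that index on
is nilpotent. -/
theorem LaurentSeries.isNilpotent_of_coeff {A : Type*} [CommRing A] {f : LaurentSeries A} {n : ℤ}
    (hnil : ∀ i < n, IsNilpotent (f.coeff i)) (hzero : ∀ i, n ≤ i → f.coeff i = 0) :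
    IsNilpotent f := by
  have hf : f = ∑ i ∈ Finset.Ico f.order n, HahnSeries.single i (f.coeff i) := by
    ext j
    rw [HahnSeries.coeff_sum, Finset.sum_eq_single j
      (fun i _ hij ↦ HahnSeries.coeff_single_of_ne hij.symm), HahnSeries.coeff_single_same]
    intro hj
    rw [HahnSeries.coeff_single_same]
    rw [Finset.mem_Ico, not_and_or, not_le, not_lt] at hj
    exact hj.elim HahnSeries.coeff_eq_zero_of_lt_order (hzero j)
  rw [hf]
  refine isNilpotent_sum fun i hi ↦ ?_
  obtain ⟨k, hk⟩ := hnil i (Finset.mem_Ico.mp hi).2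
  exact ⟨k, by rw [HahnSeries.single_pow, hk, HahnSeries.single_eq_zero]⟩

/-- A Laurent series with a unit coefficient, all of whose lower coefficients vanish, is a unit. -/
theorem LaurentSeries.isUnit_of_isUnit_coeff {A : Type*} [CommRing A] {f : LaurentSeries A} {n : ℤ}
    (hn : IsUnit (f.coeff n)) (hzero : ∀ i < n, f.coeff i = 0) : IsUnit f := by
  nontriviality A
  have hf : f ≠ 0 := by
    rintro rfl
    exact hn.ne_zero HahnSeries.coeff_zero
  have horder : f.order = n :=
    le_antisymm (HahnSeries.order_le_of_coeff_ne_zero hn.ne_zero)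
      ((HahnSeries.le_order_iff_forall hf).mpr hzero)
  refine HahnSeries.isUnit_of_isUnit_leadingCoeff_AddUnitOrder ?_ (AddGroup.isAddUnit _)
  rwa [HahnSeries.leadingCoeff_eq, horder]

/-- Let `A` be a nonzero commutative ring whose nilradical is a prime ideal
(equivalently, `Spec A` is irreducible).  A formal Laurent series
`f = Σ_i a_i z^i ∈ A((z))` is a unit of `A((z))` if and only if there exists an integer `n`
such that `a_n` is a unit of `A` and `a_i` is nilpotent for every `i < n`. -/
theorem laurentSeries_isUnit_iff_of_nilradical_isPrime
    {A : Type*} [CommRing A] [Nontrivial A] (hnil : (nilradical A).IsPrime)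
    (f : LaurentSeries A) :
    IsUnit f ↔ ∃ n : ℤ, IsUnit (f.coeff n) ∧ ∀ i : ℤ, i < n → IsNilpotent (f.coeff i) := by
  constructor
  · intro hf
    have := hnil
    let π := Ideal.Quotient.mk (nilradical A)
    have : IsLocalHom π := isLocalHom_of_le_jacobson_bot _ Ideal.radical_le_jacobson
    obtain ⟨g, hg⟩ := hf.exists_right_inv
    have hπ : IsUnit (f.map (π : A →ₙ+* A ⧸ nilradical A)) := by
      refine .of_mul_eq_one (g.map (π : A →ₙ+* A ⧸ nilradical A)) ?_
      rw [← HahnSeries.map_mul, hg]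
      exact HahnSeries.map_one π.toMonoidWithZeroHom
    rw [HahnSeries.isUnit_iff, HahnSeries.leadingCoeff_eq] at hπ
    refine ⟨_, isUnit_of_map_unit π _ hπ, fun i hi ↦ ?_⟩
    exact mem_nilradical.mp
      (Ideal.Quotient.eq_zero_iff_mem.mp (HahnSeries.coeff_eq_zero_of_lt_order hi))
  · rintro ⟨n, hn, hlt⟩
    have hlow : IsNilpotent (HahnSeries.truncLT n f) :=
      LaurentSeries.isNilpotent_of_coeff
        (fun i hi ↦ by rw [HahnSeries.coeff_truncLT_of_lt hi]; exact hlt i hi)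
        (fun i hi ↦ HahnSeries.coeff_truncLT_of_le hi f)
    have hhigh : IsUnit (f - HahnSeries.truncLT n f) :=
      LaurentSeries.isUnit_of_isUnit_coeff (n := n)
        (by rwa [HahnSeries.coeff_sub, HahnSeries.coeff_truncLT_of_le le_rfl, sub_zero])
        (fun i hi ↦ by rw [HahnSeries.coeff_sub, HahnSeries.coeff_truncLT_of_lt hi, sub_self])
    simpa using hlow.isUnit_add_left_of_commute hhigh (.all _ _)
end

section
/- Let A be a commutative ring and let f ∈ A((z)) be a unit. For each prime ideal 𝔭 of A, the image of f under the coefficientwise map A((z)) → κ(𝔭)((z)) (where κ(𝔭) is the residue field of A at 𝔭, i.e. the fraction field of A/𝔭) is a nonzero Laurent series; let v_𝔭(f) ∈ ℤ denote its order, the smallest degree carrying a nonzero coefficient. Then the function 𝔭 ↦ v_𝔭(f) is locally constant on Spec A equipped with the Zariski topology. -/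
noncomputable section

/-- The canonical ring homomorphism from `A` to the residue field `κ(𝔭)` at a prime `𝔭`,
realized as the fraction field of `A ⧸ 𝔭`. -/
def residueFieldAtPrime {A : Type*} [CommRing A] (p : PrimeSpectrum A) :
    A →+* FractionRing (A ⧸ p.asIdeal) :=
  (algebraMap (A ⧸ p.asIdeal) (FractionRing (A ⧸ p.asIdeal))).comp (Ideal.Quotient.mk p.asIdeal)

theorem LaurentSeries.order_map_add_order_map_of_mul_eq_one {A K : Type*} [CommRing A] [Field K]
    (φ : A →+* K) {f g : LaurentSeries A} (h : f * g = 1) :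
    (f.map φ : LaurentSeries K) ≠ 0 ∧
      (f.map φ : LaurentSeries K).order + (g.map φ : LaurentSeries K).order = 0 := by
  have hmul : (f.map φ * g.map φ : LaurentSeries K) = 1 := by
    have hone : ((1 : LaurentSeries A).map φ : LaurentSeries K) = 1 :=
      HahnSeries.map_one φ.toMonoidWithZeroHom
    have hprod : ((f * g).map φ : LaurentSeries K) = f.map φ * g.map φ :=
      HahnSeries.map_mul φ.toNonUnitalRingHom
    rw [← hprod, h, hone]
  have hf := left_ne_zero_of_mul_eq_one hmul
  have hg := right_ne_zero_of_mul_eq_one hmul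
  refine ⟨hf, ?_⟩
  rw [← HahnSeries.order_mul hf hg, hmul, HahnSeries.order_one]

theorem residueFieldAtPrime_ne_zero_iff {A : Type*} [CommRing A] (p : PrimeSpectrum A) (a : A) :
    residueFieldAtPrime p a ≠ 0 ↔ p ∈ PrimeSpectrum.basicOpen a := by
  simp [residueFieldAtPrime, Ideal.Quotient.eq_zero_iff_mem]

/-- Let `A` be a commutative ring and let `f ∈ A((z))` be a unit.  For each
prime ideal `𝔭` of `A`, the image of `f` under the coefficientwise map
`A((z)) → κ(𝔭)((z))` is a nonzero Laurent series; its order `v_𝔭(f)` (the smallest degree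
carrying a nonzero coefficient, i.e. `HahnSeries.order`) defines a function
`𝔭 ↦ v_𝔭(f)` which is locally constant on `Spec A` with the Zariski topology. -/
theorem isLocallyConstant_order_of_isUnit
    {A : Type*} [CommRing A] (f : LaurentSeries A) (hf : IsUnit f) :
    (∀ p : PrimeSpectrum A, f.map (residueFieldAtPrime p) ≠ 0) ∧
    IsLocallyConstant
      (fun p : PrimeSpectrum A => (f.map (residueFieldAtPrime p) : LaurentSeries _).order) := by
  obtain ⟨g, hfg⟩ := hf.exists_right_inv
  have hgf : g * f = 1 := by rw [mul_comm, hfg]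
  have order_f p := LaurentSeries.order_map_add_order_map_of_mul_eq_one (residueFieldAtPrime p) hfg
  have order_g p := LaurentSeries.order_map_add_order_map_of_mul_eq_one (residueFieldAtPrime p) hgf
  refine ⟨fun p => (order_f p).1, (IsLocallyConstant.iff_exists_open _).2 fun p => ?_⟩
  set m := (f.map (residueFieldAtPrime p) : LaurentSeries _).order
  set n := (g.map (residueFieldAtPrime p) : LaurentSeries _).order
  have hmn : m + n = 0 := (order_f p).2
  refine ⟨PrimeSpectrum.basicOpen (f.coeff m) ⊓ PrimeSpectrum.basicOpen (g.coeff n),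
    (PrimeSpectrum.basicOpen (f.coeff m) ⊓ PrimeSpectrum.basicOpen (g.coeff n)).isOpen,
    ⟨(residueFieldAtPrime_ne_zero_iff p _).1 ?_, (residueFieldAtPrime_ne_zero_iff p _).1 ?_⟩,
    fun q hq => ?_⟩
  · exact HahnSeries.coeff_order_eq_zero.not.2 (order_f p).1
  · exact HahnSeries.coeff_order_eq_zero.not.2 (order_g p).1
  · have hfq : (f.map (residueFieldAtPrime q) : LaurentSeries _).order ≤ m :=
      HahnSeries.order_le_of_coeff_ne_zero ((residueFieldAtPrime_ne_zero_iff q _).2 hq.1)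
    have hgq : (g.map (residueFieldAtPrime q) : LaurentSeries _).order ≤ n :=
      HahnSeries.order_le_of_coeff_ne_zero ((residueFieldAtPrime_ne_zero_iff q _).2 hq.2)
    have := (order_f q).2
    change (f.map (residueFieldAtPrime q) : LaurentSeries _).order = m
    linarith

end
end

section
/- Let A be a commutative ring. Suppose that in A((z)) one has an equality (1 + Σ_{i=1}^{m} b_i z^{−i}) · c · (1 + Σ_{j≥1} d_j z^j) = (1 + Σ_{i=1}^{m'} b'_i z^{−i}) · c' · (1 + Σ_{j≥1} d'_j z^j), where all b_i and b'_i are nilpotent elements of A, c and c' are units of A, and the d_j, d'_j are arbitrary elements of A. Then b_i = b'_i for all i, c = c', and d_j = d'_j for all j. (This is the injectivity at A-valued points of the natural map Γ_− × 𝔾_m × Γ_+ → A((z))^*.) -/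
noncomputable section

/-- The Laurent series `1 + Σ_{i≥1} b_i z^{-i}` attached to a finitely supported sequence
`(b_1, b_2, …)` (here `b i` is the coefficient of `z^{-(i+1)}`). -/
def gammaMinusSeries {A : Type*} [CommRing A] (b : ℕ →₀ A) : LaurentSeries A :=
  1 + b.sum fun i bi => HahnSeries.single (-(i + 1) : ℤ) bi

/-- The Laurent series `1 + Σ_{j≥1} d_j z^j` attached to a sequence `(d_1, d_2, …)`
(here `d j` is the coefficient of `z^(j+1)`). -/
def gammaPlusSeries {A : Type*} [CommRing A] (d : ℕ → A) : LaurentSeries A :=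
  HahnSeries.ofPowerSeries ℤ A (PowerSeries.mk fun j => match j with | 0 => 1 | j + 1 => d j)

end

/-- Substitution of `z⁻¹` for the variable, from polynomials to Laurent series. -/
noncomputable def polynomialInvToLaurent (A : Type*) [CommRing A] :
    Polynomial A →+* LaurentSeries A :=
  Polynomial.eval₂RingHom HahnSeries.C (HahnSeries.single (-1 : ℤ) 1)

theorem polynomialInvToLaurent_monomial {A : Type*} [CommRing A] (n : ℕ) (a : A) :
    polynomialInvToLaurent A (Polynomial.monomial n a) = HahnSeries.single (-n : ℤ) a := by
  simp [polynomialInvToLaurent, Polynomial.eval₂_monomial, HahnSeries.C_apply,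
    HahnSeries.single_pow]

theorem polynomialInvToLaurent_coeff_neg {A : Type*} [CommRing A] (p : Polynomial A) (n : ℕ) :
    (polynomialInvToLaurent A p).coeff (-n : ℤ) = p.coeff n := by
  induction p using Polynomial.induction_on' with
  | add p q hp hq => simp [hp, hq]
  | monomial m a =>
    simp [polynomialInvToLaurent_monomial, HahnSeries.coeff_single, Polynomial.coeff_monomial,
      eq_comm]

theorem ofPowerSeries_coeff_of_neg {A : Type*} [CommRing A] (q : PowerSeries A) {n : ℤ}
    (hn : n < 0) : (HahnSeries.ofPowerSeries ℤ A q).coeff n = 0 := by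
  rw [HahnSeries.ofPowerSeries_apply]
  refine HahnSeries.embDomain_of_notMem_range ?_
  rintro ⟨m, hm⟩
  simp at hm
  omega

/-- A polynomial in `z⁻¹` with constant coefficient `1` that is a power series in `z` is `1`. -/
theorem eq_one_of_polynomialInvToLaurent_eq_ofPowerSeries {A : Type*} [CommRing A]
    {p : Polynomial A} {q : PowerSeries A} (hp : p.coeff 0 = 1)
    (h : polynomialInvToLaurent A p = HahnSeries.ofPowerSeries ℤ A q) : p = 1 := by
  ext n
  rcases n.eq_zero_or_pos with rfl | hn
  · simp [hp]
  · rw [← polynomialInvToLaurent_coeff_neg, h, ofPowerSeries_coeff_of_neg q (by omega),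
      Polynomial.coeff_one, if_neg hn.ne']

theorem polynomialInv_mul_powerSeries_injective {A : Type*} [CommRing A] {p p' : Polynomial A}
    {q q' : PowerSeries A} (hp : p.coeff 0 = 1) (hp' : p'.coeff 0 = 1) (hpu' : IsUnit p')
    (hq : IsUnit q)
    (h : polynomialInvToLaurent A p * HahnSeries.ofPowerSeries ℤ A q
      = polynomialInvToLaurent A p' * HahnSeries.ofPowerSeries ℤ A q') :
    p = p' ∧ q = q' := by
  obtain ⟨r, hr⟩ := hpu'.exists_right_inv
  obtain ⟨s, hs⟩ := hq.exists_right_inv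
  have hr0 : r.coeff 0 = 1 := by
    simpa [Polynomial.mul_coeff_zero, hp'] using congrArg (fun f => f.coeff 0) hr
  have hr1 := congrArg (polynomialInvToLaurent A) hr
  have hs1 := congrArg (HahnSeries.ofPowerSeries ℤ A) hs
  rw [map_mul, map_one] at hr1 hs1
  have hpr : p * r = 1 := by
    refine eq_one_of_polynomialInvToLaurent_eq_ofPowerSeries (q := q' * s)
      (by simp [Polynomial.mul_coeff_zero, hp, hr0]) ?_
    rw [map_mul, map_mul]
    linear_combination (polynomialInvToLaurent A r * HahnSeries.ofPowerSeries ℤ A s) * h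
      - polynomialInvToLaurent A p * polynomialInvToLaurent A r * hs1
      + HahnSeries.ofPowerSeries ℤ A q' * HahnSeries.ofPowerSeries ℤ A s * hr1
  have hpp : p = p' := by linear_combination p' * hpr - p * hr
  subst hpp
  exact ⟨rfl, HahnSeries.ofPowerSeries_injective ((hpu'.map _).mul_left_cancel h)⟩

/-- The polynomial `1 + Σ b_i X^(i+1)`. -/
noncomputable def gammaMinusPolynomial {A : Type*} [CommRing A] (b : ℕ →₀ A) : Polynomial A :=
  1 + b.sum fun i bi => Polynomial.monomial (i + 1) bi

theorem polynomialInvToLaurent_gammaMinusPolynomial {A : Type*} [CommRing A] (b : ℕ →₀ A) :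
    polynomialInvToLaurent A (gammaMinusPolynomial b) = gammaMinusSeries b := by
  simp [gammaMinusPolynomial, gammaMinusSeries, Finsupp.sum, polynomialInvToLaurent_monomial]

theorem gammaMinusPolynomial_coeff_zero {A : Type*} [CommRing A] (b : ℕ →₀ A) :
    (gammaMinusPolynomial b).coeff 0 = 1 := by
  simp [gammaMinusPolynomial, Finsupp.sum, Polynomial.coeff_monomial]

theorem gammaMinusPolynomial_coeff_succ {A : Type*} [CommRing A] (b : ℕ →₀ A) (n : ℕ) :
    (gammaMinusPolynomial b).coeff (n + 1) = b n := by
  simp +contextual [gammaMinusPolynomial, Finsupp.sum, Polynomial.coeff_monomial,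
    Polynomial.coeff_one]

theorem isUnit_gammaMinusPolynomial {A : Type*} [CommRing A] {b : ℕ →₀ A}
    (hb : ∀ i, IsNilpotent (b i)) : IsUnit (gammaMinusPolynomial b) := by
  rw [Polynomial.isUnit_iff_coeff_isUnit_isNilpotent]
  refine ⟨by simp [gammaMinusPolynomial_coeff_zero], fun i hi => ?_⟩
  obtain ⟨n, rfl⟩ := Nat.exists_eq_succ_of_ne_zero hi
  simpa [gammaMinusPolynomial_coeff_succ] using hb n

/-- Injectivity at `A`-valued points of `Γ_- × 𝔾_m × Γ_+ → A((z))^*`: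
if `(1 + Σ b_i z^{-i})·c·(1 + Σ d_j z^j) = (1 + Σ b'_i z^{-i})·c'·(1 + Σ d'_j z^j)` in
`A((z))`, with the `b_i, b'_i` nilpotent and `c, c'` units, then `b = b'`, `c = c'` and
`d = d'`. -/
theorem gammaFactorization_injective {A : Type*} [CommRing A]
    (b b' : ℕ →₀ A) (hb : ∀ i, IsNilpotent (b i)) (hb' : ∀ i, IsNilpotent (b' i))
    (c c' : A) (hc : IsUnit c) (hc' : IsUnit c') (d d' : ℕ → A)
    (h : gammaMinusSeries b * HahnSeries.C c * gammaPlusSeries d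
        = gammaMinusSeries b' * HahnSeries.C c' * gammaPlusSeries d') :
    b = b' ∧ c = c' ∧ d = d' := by
  rw [gammaPlusSeries, gammaPlusSeries, ← HahnSeries.ofPowerSeries_C, ← HahnSeries.ofPowerSeries_C,
    mul_assoc, mul_assoc, ← map_mul, ← map_mul, ← polynomialInvToLaurent_gammaMinusPolynomial,
    ← polynomialInvToLaurent_gammaMinusPolynomial] at h
  obtain ⟨hp, hq⟩ := polynomialInv_mul_powerSeries_injective (gammaMinusPolynomial_coeff_zero b)
    (gammaMinusPolynomial_coeff_zero b') (isUnit_gammaMinusPolynomial hb')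
    (PowerSeries.isUnit_iff_constantCoeff.2 (by
      simpa [← PowerSeries.coeff_zero_eq_constantCoeff_apply] using hc)) h
  have hcc : c = c' := by
    simpa [PowerSeries.coeff_C_mul] using congrArg (PowerSeries.coeff 0) hq
  subst hcc
  refine ⟨?_, rfl, ?_⟩
  · ext n
    rw [← gammaMinusPolynomial_coeff_succ, hp, gammaMinusPolynomial_coeff_succ]
  · ext n
    have hn := congrArg (PowerSeries.coeff (n + 1)) hq
    simp only [PowerSeries.coeff_C_mul, PowerSeries.coeff_mk] at hn
    exact hc.mul_left_cancel hn
end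

section
/- Let A be a commutative ℚ-algebra and let f = Σ_i a_i z^i ∈ A((z)) be such that a_i is nilpotent for every i < 0 and a_0 is a unit of A. Then f is a unit of A((z)) and there exist a unique finitely supported family of nilpotent elements b_1, …, b_m of A, a unique unit c of A, and unique elements d_1, d_2, … of A such that f = (1 + Σ_{i=1}^{m} b_i z^{−i}) · c · (1 + Σ_{j≥1} d_j z^j). -/
namespace NonUnitalSubring

theorem exists_one_add_mul_one_add_eq_one {R : Type*} [CommRing R] (S : NonUnitalSubring R)
    {x : R} (hx : x ∈ S) (hnil : IsNilpotent x) : ∃ y ∈ S, (1 + x) * (1 + y) = 1 := by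
  obtain ⟨n, hn⟩ := hnil
  replace hn : x ^ 2 ^ n = 0 := pow_eq_zero_of_le n.lt_two_pow_self.le hn
  induction n generalizing x with
  | zero => exact ⟨0, S.zero_mem, by simp_all⟩
  | succ n ih =>
    obtain ⟨y, hy, h⟩ := ih (S.neg_mem (S.mul_mem hx hx)) (by
      rw [neg_pow, ← sq, ← pow_mul, ← pow_succ', hn, mul_zero])
    refine ⟨y - x - x * y, S.sub_mem (S.sub_mem hy hx) (S.mul_mem hx hy), ?_⟩
    linear_combination h

end NonUnitalSubring

namespace LaurentSeries

open HahnSeries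

variable {A : Type*} [CommRing A]

theorem coeff_mul_mem_mul {I J : Ideal A} {x y : LaurentSeries A} (hx : ∀ i, x.coeff i ∈ I)
    (hy : ∀ i, y.coeff i ∈ J) (i : ℤ) : (x * y).coeff i ∈ I * J := by
  rw [coeff_mul]
  exact Ideal.sum_mem _ fun ij _ => Ideal.mul_mem_mul (hx _) (hy _)

theorem coeff_mul_mem_right {I : Ideal A} (x : LaurentSeries A) {y : LaurentSeries A}
    (hy : ∀ i, y.coeff i ∈ I) (i : ℤ) : (x * y).coeff i ∈ I := by
  rw [coeff_mul]
  exact Ideal.sum_mem _ fun ij _ => I.mul_mem_left _ (hy _)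

theorem coeff_pow_mem_pow {I : Ideal A} {x : LaurentSeries A} (hx : ∀ i, x.coeff i ∈ I) (n : ℕ)
    (i : ℤ) : (x ^ n).coeff i ∈ I ^ n := by
  induction n generalizing i with
  | zero => simp
  | succ n ih =>
    rw [pow_succ, pow_succ]
    exact coeff_mul_mem_mul ih hx i

theorem exists_isNilpotent_ideal_coeff_mem {f : LaurentSeries A}
    (hf : ∀ i < 0, IsNilpotent (f.coeff i)) :
    ∃ I : Ideal A, IsNilpotent I ∧ ∀ i < 0, f.coeff i ∈ I := by
  refine ⟨Ideal.span (f.coeff '' Set.Ico f.order 0), ?_, fun i hi => ?_⟩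
  · rw [Ideal.FG.isNilpotent_iff_le_nilradical
      (Submodule.fg_span ((Set.finite_Ico _ _).image _)), Ideal.span_le]
    rintro _ ⟨i, hi, rfl⟩
    exact hf i hi.2
  · by_cases h : i < f.order
    · rw [coeff_eq_zero_of_lt_order h]
      exact zero_mem _
    · exact Ideal.subset_span ⟨i, ⟨not_lt.1 h, hi⟩, rfl⟩

variable (A) in
/-- The Laurent series with nilpotent coefficients and only negative exponents. -/
def negNilSubring : NonUnitalSubring (LaurentSeries A) where
  carrier := {x | (∀ i, 0 ≤ i → x.coeff i = 0) ∧ ∀ i, x.coeff i ∈ nilradical A}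
  zero_mem' := by simp
  add_mem' := fun ⟨hx, hx'⟩ ⟨hy, hy'⟩ =>
    ⟨fun i hi => by simp [hx i hi, hy i hi], fun i => add_mem (hx' i) (hy' i)⟩
  neg_mem' := fun ⟨hx, hx'⟩ => ⟨fun i hi => by simp [hx i hi], fun i => neg_mem (hx' i)⟩
  mul_mem' := by
    rintro x y ⟨hx, -⟩ ⟨hy, hy'⟩
    refine ⟨fun i hi => ?_, coeff_mul_mem_right x hy'⟩
    rw [coeff_mul]
    refine Finset.sum_eq_zero fun ij hij => ?_
    have h : ij.1 + ij.2 = i := by simp_all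
    rcases le_or_gt 0 ij.1 with h1 | h1
    · rw [hx _ h1, zero_mul]
    · rw [hy _ (by lia), mul_zero]

theorem isNilpotent_of_mem_negNilSubring {x : LaurentSeries A} (hx : x ∈ negNilSubring A) :
    IsNilpotent x := by
  obtain ⟨I, ⟨n, hn⟩, hI⟩ := exists_isNilpotent_ideal_coeff_mem fun i _ => hx.2 i
  refine ⟨n, HahnSeries.ext (funext fun i => ?_)⟩
  have hxI (i : ℤ) : x.coeff i ∈ I := by
    rcases lt_or_ge i 0 with h | h
    · exact hI i h
    · rw [hx.1 i h]
      exact zero_mem _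
  simpa [hn] using coeff_pow_mem_pow hxI n i

theorem exists_mem_negNilSubring_one_add_mul_eq_one {x : LaurentSeries A}
    (hx : x ∈ negNilSubring A) : ∃ y ∈ negNilSubring A, (1 + x) * (1 + y) = 1 :=
  (negNilSubring A).exists_one_add_mul_one_add_eq_one hx (isNilpotent_of_mem_negNilSubring hx)

theorem coeff_ofPowerSeries_of_neg (P : PowerSeries A) {i : ℤ} (hi : i < 0) :
    (ofPowerSeries ℤ A P).coeff i = 0 := by
  rw [PowerSeries.coeff_coe, if_pos hi]

theorem eq_ofPowerSeries_of_coeff_neg {f : LaurentSeries A} (hf : ∀ i < 0, f.coeff i = 0) :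
    f = ofPowerSeries ℤ A (PowerSeries.mk fun n => f.coeff n) := by
  ext i
  rcases lt_or_ge i 0 with h | h
  · rw [hf i h, coeff_ofPowerSeries_of_neg _ h]
  · lift i to ℕ using h
    rw [coeff_coe_powerSeries, PowerSeries.coeff_mk]

theorem exists_ofPowerSeries_eq_sub_truncLT (f : LaurentSeries A) :
    ∃ P : PowerSeries A, ofPowerSeries ℤ A P = f - truncLT 0 f ∧
      PowerSeries.constantCoeff P = f.coeff 0 :=
  ⟨_, (eq_ofPowerSeries_of_coeff_neg fun i hi => by simp [hi]).symm, by simp⟩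

theorem exists_one_add_mul_coeff_mem_mul {I : Ideal A} (hI : I ≤ nilradical A)
    {f : LaurentSeries A} (hneg : ∀ i < 0, f.coeff i ∈ I) (h0 : IsUnit (f.coeff 0)) :
    ∃ u ∈ negNilSubring A, (∀ i < 0, (f * (1 + u)).coeff i ∈ I * I) ∧
      IsUnit ((f * (1 + u)).coeff 0) := by
  obtain ⟨P, hP, hP0⟩ := exists_ofPowerSeries_eq_sub_truncLT f
  obtain ⟨Q, hQ⟩ := (PowerSeries.isUnit_iff_constantCoeff.2 (hP0 ▸ h0)).exists_right_inv
  have hPQ : ofPowerSeries ℤ A P * ofPowerSeries ℤ A Q = 1 := by rw [← map_mul, hQ, map_one]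
  have hν (i : ℤ) : (truncLT 0 f).coeff i ∈ I := by
    rw [HahnSeries.coeff_truncLT]
    split_ifs with h
    exacts [hneg i h, zero_mem _]
  set g := ofPowerSeries ℤ A Q * truncLT 0 f with hg
  have hgI : ∀ i, g.coeff i ∈ I := coeff_mul_mem_right _ hν
  have hgI' (i : ℤ) : (truncLT 0 g).coeff i ∈ I := by
    rw [HahnSeries.coeff_truncLT]
    split_ifs
    exacts [hgI i, zero_mem _]
  obtain ⟨G, hG, -⟩ := exists_ofPowerSeries_eq_sub_truncLT g
  have hmem : -truncLT 0 g ∈ negNilSubring A :=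
    neg_mem ⟨fun i hi => by simp [hi.not_gt], fun i => hI (hgI' i)⟩
  have key : f * (1 + -truncLT 0 g) = ofPowerSeries ℤ A (P * (1 + G)) -
      ofPowerSeries ℤ A P * (g * truncLT 0 g) := by
    have hPG : ofPowerSeries ℤ A (P * (1 + G)) =
        ofPowerSeries ℤ A P * (1 + (g - truncLT 0 g)) := by
      rw [map_mul, map_add, map_one, hG]
    rw [hPG]
    linear_combination (-1 + truncLT 0 g) * hP - (truncLT 0 f * (1 - truncLT 0 g)) * hPQ +
      ofPowerSeries ℤ A P * (1 - truncLT 0 g) * hg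
  refine ⟨_, hmem, fun i hi => ?_, ?_⟩
  · rw [key, coeff_sub, coeff_ofPowerSeries_of_neg _ hi, zero_sub]
    exact neg_mem (coeff_mul_mem_right _ (coeff_mul_mem_mul hgI hgI') i)
  · have hnil : f.coeff 0 - (f * (1 + -truncLT 0 g)).coeff 0 ∈ nilradical A := by
      have : f.coeff 0 - (f * (1 + -truncLT 0 g)).coeff 0 = -(f * -truncLT 0 g).coeff 0 := by
        rw [mul_add, mul_one, coeff_add]
        ring
      rw [this]
      exact neg_mem (coeff_mul_mem_right _ hmem.2 0)
    have := IsNilpotent.isUnit_add_left_of_commute (neg_mem hnil) h0 (Commute.all _ _)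
    convert this using 1
    ring

theorem exists_one_add_mul_coeff_neg_eq_zero {f : LaurentSeries A}
    (hneg : ∀ i < 0, IsNilpotent (f.coeff i)) (h0 : IsUnit (f.coeff 0)) :
    ∃ u ∈ negNilSubring A, (∀ i < 0, (f * (1 + u)).coeff i = 0) ∧
      IsUnit ((f * (1 + u)).coeff 0) := by
  obtain ⟨I, ⟨n, hn⟩, hI⟩ := exists_isNilpotent_ideal_coeff_mem hneg
  replace hn : I ^ 2 ^ n = 0 := pow_eq_zero_of_le n.lt_two_pow_self.le hn
  clear hneg
  induction n generalizing f I with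
  | zero =>
    refine ⟨0, zero_mem _, fun i hi => ?_, by simpa using h0⟩
    simpa [show I = ⊥ by simpa using hn] using hI i hi
  | succ n ih =>
    have hle : I ≤ nilradical A := fun a ha =>
      ⟨2 ^ (n + 1), by simpa [hn] using Ideal.pow_mem_pow ha (2 ^ (n + 1))⟩
    obtain ⟨u, hu, hu1, hu2⟩ := exists_one_add_mul_coeff_mem_mul hle hI h0
    obtain ⟨v, hv, hv1⟩ := ih hu2 (I * I) hu1 (by rw [← sq, ← pow_mul, ← pow_succ', hn])
    refine ⟨u + v + u * v, add_mem (add_mem hu hv) (mul_mem hu hv), ?_⟩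
    rwa [show f * (1 + (u + v + u * v)) = f * (1 + u) * (1 + v) by ring]

theorem exists_eq_one_add_mul_ofPowerSeries {f : LaurentSeries A}
    (hneg : ∀ i < 0, IsNilpotent (f.coeff i)) (h0 : IsUnit (f.coeff 0)) :
    ∃ u ∈ negNilSubring A, ∃ P : PowerSeries A, IsUnit P ∧
      f = (1 + u) * ofPowerSeries ℤ A P := by
  obtain ⟨v, hv, hv1, hv2⟩ := exists_one_add_mul_coeff_neg_eq_zero hneg h0
  obtain ⟨u, hu, huv⟩ := exists_mem_negNilSubring_one_add_mul_eq_one hv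
  refine ⟨u, hu, PowerSeries.mk fun n => (f * (1 + v)).coeff n, ?_, ?_⟩
  · rw [PowerSeries.isUnit_iff_constantCoeff]
    simpa using hv2
  · rw [← eq_ofPowerSeries_of_coeff_neg hv1]
    linear_combination -f * huv

theorem one_add_mul_ofPowerSeries_injective {u v : LaurentSeries A} (hu : u ∈ negNilSubring A)
    (hv : v ∈ negNilSubring A) {P Q : PowerSeries A} (hQ : IsUnit Q)
    (h : (1 + u) * ofPowerSeries ℤ A P = (1 + v) * ofPowerSeries ℤ A Q) : u = v ∧ P = Q := by
  obtain ⟨w, hw, huw⟩ := exists_mem_negNilSubring_one_add_mul_eq_one hu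
  obtain ⟨E, hE⟩ := hQ.exists_right_inv
  have hQE : ofPowerSeries ℤ A Q * ofPowerSeries ℤ A E = 1 := by rw [← map_mul, hE, map_one]
  have hδ : v + w + v * w ∈ negNilSubring A := add_mem (add_mem hv hw) (mul_mem hv hw)
  have heq : v + w + v * w = ofPowerSeries ℤ A (P * E - 1) := by
    rw [map_sub, map_one, map_mul]
    linear_combination -(1 + w) * ofPowerSeries ℤ A E * h +
      ofPowerSeries ℤ A P * ofPowerSeries ℤ A E * huw - (1 + w) * (1 + v) * hQE
  have hzero : v + w + v * w = 0 := by
    ext i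
    rcases lt_or_ge i 0 with hi | hi
    · rw [heq, coeff_ofPowerSeries_of_neg _ hi, coeff_zero]
    · rw [hδ.1 i hi, coeff_zero]
  have huv : u = v := by linear_combination -(1 + u) * hzero + (1 + v) * huw
  refine ⟨huv, ofPowerSeries_injective (Γ := ℤ) ?_⟩
  subst huv
  linear_combination (1 + w) * h - (ofPowerSeries ℤ A P - ofPowerSeries ℤ A Q) * huw

theorem coeff_sum_single_neg (b : ℕ →₀ A) (n : ℕ) :
    (b.sum fun i bi => (single (-(i + 1) : ℤ) bi : LaurentSeries A)).coeff (-(n + 1)) = b n := by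
  rw [Finsupp.sum, coeff_sum, Finset.sum_eq_single n]
  · simp
  · intro m _ hm
    exact coeff_single_of_ne (by lia)
  · intro hn
    simpa using hn

theorem coeff_sum_single_of_nonneg (b : ℕ →₀ A) {i : ℤ} (hi : 0 ≤ i) :
    (b.sum fun i bi => (single (-(i + 1) : ℤ) bi : LaurentSeries A)).coeff i = 0 := by
  rw [Finsupp.sum, coeff_sum]
  exact Finset.sum_eq_zero fun m _ => coeff_single_of_ne (by lia)

theorem sum_single_mem_negNilSubring {b : ℕ →₀ A} (hb : ∀ i, IsNilpotent (b i)) :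
    (b.sum fun i bi => (single (-(i + 1) : ℤ) bi : LaurentSeries A)) ∈ negNilSubring A := by
  refine ⟨fun i hi => coeff_sum_single_of_nonneg b hi, fun i => ?_⟩
  rcases lt_or_ge i 0 with hi | hi
  · obtain ⟨n, rfl⟩ : ∃ n : ℕ, i = -(n + 1) := ⟨(-i - 1).toNat, by lia⟩
    rw [coeff_sum_single_neg]
    exact hb n
  · rw [coeff_sum_single_of_nonneg b hi]
    exact zero_mem _

theorem exists_sum_single_eq {u : LaurentSeries A} (hu : u ∈ negNilSubring A) :
    ∃ b : ℕ →₀ A, (∀ i, IsNilpotent (b i)) ∧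
      (b.sum fun i bi => (single (-(i + 1) : ℤ) bi : LaurentSeries A)) = u := by
  have hfin : (Function.support fun n : ℕ => u.coeff (-(n + 1))).Finite := by
    refine (Set.finite_Iio (-u.order).toNat).subset fun n hn => ?_
    by_contra hlt
    exact hn (coeff_eq_zero_of_lt_order (by simp at hlt; lia))
  refine ⟨Finsupp.ofSupportFinite _ hfin, fun i => hu.2 _, ?_⟩
  ext i
  rcases lt_or_ge i 0 with hi | hi
  · obtain ⟨n, rfl⟩ : ∃ n : ℕ, i = -(n + 1) := ⟨(-i - 1).toNat, by lia⟩
    rw [coeff_sum_single_neg]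
    rfl
  · rw [coeff_sum_single_of_nonneg _ hi, hu.1 i hi]

/-- The power series `1 + Σ_{j≥1} d_j z^j`, where `d j` is the coefficient of `z^(j+1)`. -/
def oneAddSeries (d : ℕ → A) : PowerSeries A :=
  PowerSeries.mk fun j => match j with | 0 => 1 | j + 1 => d j

theorem C_mul_gammaPlusSeries (c : A) (d : ℕ → A) :
    HahnSeries.C c * gammaPlusSeries d = ofPowerSeries ℤ A (PowerSeries.C c * oneAddSeries d) := by
  rw [map_mul, ofPowerSeries_C]
  rfl

theorem isUnit_C_mul_oneAddSeries {c : A} (hc : IsUnit c) (d : ℕ → A) :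
    IsUnit (PowerSeries.C c * oneAddSeries d) := by
  rw [PowerSeries.isUnit_iff_constantCoeff]
  simpa [oneAddSeries] using hc

theorem exists_C_mul_oneAddSeries_eq {P : PowerSeries A} (hP : IsUnit P) :
    ∃ c d, IsUnit c ∧ PowerSeries.C c * oneAddSeries d = P := by
  have h0 := PowerSeries.isUnit_iff_constantCoeff.1 hP
  obtain ⟨e, he⟩ := h0.exists_right_inv
  refine ⟨PowerSeries.constantCoeff P, fun j => e * PowerSeries.coeff (j + 1) P, h0, ?_⟩
  ext n
  rw [PowerSeries.coeff_C_mul, oneAddSeries, PowerSeries.coeff_mk]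
  cases n with
  | zero => simp
  | succ n => rw [← mul_assoc, he, one_mul]

theorem C_mul_oneAddSeries_injective {c c' : A} (hc : IsUnit c) {d d' : ℕ → A}
    (h : PowerSeries.C c * oneAddSeries d = PowerSeries.C c' * oneAddSeries d') :
    c = c' ∧ d = d' := by
  have hcoeff (n : ℕ) := congrArg (PowerSeries.coeff n) h
  simp only [PowerSeries.coeff_C_mul, oneAddSeries, PowerSeries.coeff_mk] at hcoeff
  obtain rfl : c = c' := by simpa using hcoeff 0
  exact ⟨rfl, funext fun n => hc.mul_left_cancel (hcoeff (n + 1))⟩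

end LaurentSeries

open LaurentSeries in
/-- Let `A` be a commutative `ℚ`-algebra and let `f = Σ_i a_i z^i ∈ A((z))`
be such that `a_i` is nilpotent for every `i < 0` and `a_0` is a unit of `A`.  Then `f` is a
unit of `A((z))` and there are a unique finitely supported family of nilpotent elements
`b_1, …, b_m` of `A`, a unique unit `c` of `A` and unique elements `d_1, d_2, …` of `A` with
`f = (1 + Σ_{i=1}^m b_i z^{-i}) · c · (1 + Σ_{j≥1} d_j z^j)`. -/
theorem gammaFactorization_exists_unique {A : Type*} [CommRing A] [Algebra ℚ A]
    (f : LaurentSeries A)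
    (hneg : ∀ i : ℤ, i < 0 → IsNilpotent (f.coeff i)) (h0 : IsUnit (f.coeff 0)) :
    IsUnit f ∧
      ∃! t : (ℕ →₀ A) × A × (ℕ → A),
        (∀ i, IsNilpotent (t.1 i)) ∧ IsUnit t.2.1 ∧
          f = gammaMinusSeries t.1 * HahnSeries.C t.2.1 * gammaPlusSeries t.2.2 := by
  obtain ⟨u, hu, P, hP, hf⟩ := exists_eq_one_add_mul_ofPowerSeries hneg h0
  obtain ⟨v, -, huv⟩ := exists_mem_negNilSubring_one_add_mul_eq_one hu
  obtain ⟨b, hb, hbu⟩ := exists_sum_single_eq hu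
  obtain ⟨c, d, hc, hcd⟩ := exists_C_mul_oneAddSeries_eq hP
  refine ⟨?_, (b, c, d), ⟨hb, hc, ?_⟩, ?_⟩
  · rw [hf]
    exact (IsUnit.of_mul_eq_one _ huv).mul (hP.map _)
  · rw [mul_assoc, C_mul_gammaPlusSeries, hcd, gammaMinusSeries, hbu, hf]
  · rintro ⟨b', c', d'⟩ ⟨hb', hc', hf'⟩
    rw [mul_assoc, C_mul_gammaPlusSeries, gammaMinusSeries, hf] at hf'
    obtain ⟨huu, hPP⟩ := one_add_mul_ofPowerSeries_injective hu
      (sum_single_mem_negNilSubring hb') (isUnit_C_mul_oneAddSeries hc' d') hf'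
    obtain ⟨rfl, rfl⟩ := C_mul_oneAddSeries_injective hc (hcd.trans hPP)
    have hbb : b' = b := by
      ext n
      rw [← coeff_sum_single_neg b', ← coeff_sum_single_neg b, hbu, ← huu]
    rw [hbb]
end

section
/- Let A be a commutative ring. Let N be the set of sequences (a_1, a_2, …) of nilpotent elements of A with only finitely many nonzero terms, and let G be the set of Laurent series in A((z)) of the form 1 + Σ_{i=1}^{m} b_i z^{−i} with every b_i ∈ A nilpotent. Then the map N → G given by (a_i) ↦ Π_{i>0} (1 − a_i z^{−i}) (a finite product) is a bijection. (This is the exponential map of the formal group Γ_− in positive characteristic, at the level of A-valued points.) -/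
noncomputable section

/-- Membership in the set `G` of Laurent series of the form `1 + Σ_{i=1}^m b_i z^{-i}`
with all `b_i` nilpotent. -/
def IsGammaMinusElt {A : Type*} [CommRing A] (f : LaurentSeries A) : Prop :=
  ∃ b : ℕ →₀ A, (∀ i, IsNilpotent (b i)) ∧ f = gammaMinusSeries b

/-- The finite product `Π_{i>0} (1 - a_i z^{-i})` attached to a finitely supported sequence
`(a_1, a_2, …)` (here `a i` contributes the factor `1 - a_i z^{-(i+1)}`). -/
def wittProdSeries {A : Type*} [CommRing A] (a : ℕ →₀ A) : LaurentSeries A :=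
  a.prod fun i ai => 1 - HahnSeries.single (-(i + 1) : ℤ) ai

open Polynomial in
/-- The polynomial `Σ_i c_i X^{i+1}` attached to a finitely supported sequence. -/
def shiftedPoly {A : Type*} [CommRing A] (c : ℕ →₀ A) : A[X] :=
  c.sum fun i ci => monomial (i + 1) ci

open Polynomial in
/-- The polynomial `Π_i (1 - a_i X^{i+1})` attached to a finitely supported sequence. -/
def wittProdPoly {A : Type*} [CommRing A] (a : ℕ →₀ A) : A[X] :=
  a.prod fun i ai => 1 - monomial (i + 1) ai

open Polynomial in
/-- The ring homomorphism `A[X] → A((z))` sending `X` to `z^{-1}`. -/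
def polyInvVar (A : Type*) [CommRing A] : A[X] →+* LaurentSeries A :=
  eval₂RingHom HahnSeries.C (HahnSeries.single (-1 : ℤ) 1)

section

open Polynomial

variable {A : Type*} [CommRing A]

theorem polyInvVar_monomial (n : ℕ) (r : A) :
    polyInvVar A (monomial n r) = HahnSeries.single (-n : ℤ) r := by
  simp [polyInvVar, eval₂_monomial, HahnSeries.single_pow, HahnSeries.C_apply,
    HahnSeries.single_mul_single]

theorem coeff_polyInvVar (p : A[X]) (n : ℕ) :
    (polyInvVar A p).coeff (-n : ℤ) = p.coeff n := by
  induction p using Polynomial.induction_on' with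
  | add p q hp hq => simp [hp, hq]
  | monomial m r =>
    rw [polyInvVar_monomial, coeff_monomial, HahnSeries.coeff_single]
    simp [eq_comm]

theorem polyInvVar_injective : Function.Injective (polyInvVar A) := fun p q h => by
  ext n
  rw [← coeff_polyInvVar, h, coeff_polyInvVar]

theorem polyInvVar_shiftedPoly (b : ℕ →₀ A) :
    polyInvVar A (1 + shiftedPoly b) = gammaMinusSeries b := by
  simp [shiftedPoly, gammaMinusSeries, Finsupp.sum, polyInvVar_monomial]

theorem polyInvVar_wittProdPoly (a : ℕ →₀ A) :
    polyInvVar A (wittProdPoly a) = wittProdSeries a := by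
  simp [wittProdPoly, wittProdSeries, Finsupp.prod, polyInvVar_monomial]

theorem coeff_shiftedPoly_zero (c : ℕ →₀ A) : (shiftedPoly c).coeff 0 = 0 := by
  simp [shiftedPoly, Finsupp.sum, coeff_monomial]

theorem coeff_shiftedPoly_succ (c : ℕ →₀ A) (n : ℕ) : (shiftedPoly c).coeff (n + 1) = c n := by
  simp [shiftedPoly, Finsupp.sum, coeff_monomial, eq_comm]

theorem exists_shiftedPoly_eq {q : A[X]} (hq : q.coeff 0 = 0) :
    ∃ c : ℕ →₀ A, shiftedPoly c = q := by
  refine ⟨Finsupp.onFinset (Finset.range q.natDegree) (fun i => q.coeff (i + 1)) ?_, ?_⟩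
  · intro i hi
    simpa [Nat.succ_le_iff] using le_natDegree_of_ne_zero hi
  · ext n
    cases n with
    | zero => rw [coeff_shiftedPoly_zero, hq]
    | succ n => rw [coeff_shiftedPoly_succ, Finsupp.onFinset_apply]

theorem coeff_wittProdPoly_zero (a : ℕ →₀ A) : (wittProdPoly a).coeff 0 = 1 := by
  simp [wittProdPoly, Finsupp.prod, coeff_zero_prod, coeff_monomial]

theorem shiftedPoly_mem_map_C {J : Ideal A} {c : ℕ →₀ A} :
    shiftedPoly c ∈ J.map C ↔ ∀ i, c i ∈ J := by
  rw [Ideal.mem_map_C_iff]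
  refine ⟨fun h i => coeff_shiftedPoly_succ c i ▸ h (i + 1), fun h n => ?_⟩
  cases n with
  | zero => simp [coeff_shiftedPoly_zero]
  | succ n => simpa [coeff_shiftedPoly_succ] using h n

theorem prod_one_sub_sub_one_mem {ι R : Type*} [CommRing R] {I : Ideal R} (s : Finset ι)
    {x : ι → R} (hx : ∀ i, x i ∈ I) : ∏ i ∈ s, (1 - x i) - 1 ∈ I := by
  classical
  induction s using Finset.induction_on with
  | empty => simp
  | insert j s hj ih =>
    rw [Finset.prod_insert hj]
    have h := I.sub_mem ih (I.mul_mem_right (∏ i ∈ s, (1 - x i)) (hx j))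
    convert h using 1
    ring

/-- First-order expansion of `Π (1 - x_i)` when the `x_i` are perturbed by elements of `J`. -/
theorem prod_one_sub_sub_expansion_mem {ι R : Type*} [CommRing R] {I J : Ideal R} (hJI : J ≤ I)
    (s : Finset ι) {x y : ι → R} (hx : ∀ i, x i ∈ I) (hy : ∀ i, y i ∈ J) :
    ∏ i ∈ s, (1 - (x i - y i)) - (∏ i ∈ s, (1 - x i) + ∑ i ∈ s, y i) ∈ I * J := by
  classical
  induction s using Finset.induction_on with
  | empty => simp
  | insert j s hj ih =>
    rw [Finset.prod_insert hj, Finset.prod_insert hj, Finset.sum_insert hj]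
    have h₁ := Ideal.mul_mem_mul (prod_one_sub_sub_one_mem s hx) (hy j)
    have h₂ := Ideal.mul_mem_mul (I.sub_mem (hJI (hy j)) (hx j))
      (J.sum_mem fun i (_ : i ∈ s) => hy i)
    have h₃ := (I * J).mul_mem_left (1 - (x j - y j)) ih
    convert (I * J).add_mem ((I * J).add_mem h₁ h₂) h₃ using 1
    ring

theorem wittProdPoly_sub_expansion_mem {I J : Ideal A} (hJI : J ≤ I) {a c : ℕ →₀ A}
    (ha : ∀ i, a i ∈ I) (hc : ∀ i, c i ∈ J) :
    wittProdPoly (a - c) - (wittProdPoly a + shiftedPoly c) ∈ (I * J).map C := by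
  classical
  have hmono {K : Ideal A} {f : ℕ →₀ A} (hf : ∀ i, f i ∈ K) (i : ℕ) :
      monomial (i + 1) (f i) ∈ K.map C := by
    rw [← C_mul_X_pow_eq_monomial]
    exact Ideal.mul_mem_right _ _ (Ideal.mem_map_of_mem C (hf i))
  have h := prod_one_sub_sub_expansion_mem (Ideal.map_mono hJI) (a.support ∪ c.support)
    (hmono ha) (hmono hc)
  rw [Ideal.map_mul]
  unfold wittProdPoly shiftedPoly
  rw [Finsupp.prod_of_support_subset (a - c) Finsupp.support_sub _ (by simp),
    Finsupp.prod_of_support_subset a Finset.subset_union_left _ (by simp),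
    Finsupp.sum_of_support_subset c Finset.subset_union_right _ (by simp)]
  simpa using h

theorem wittProdPoly_sub_one_mem {I : Ideal A} {a : ℕ →₀ A} (ha : ∀ i, a i ∈ I) :
    wittProdPoly a - 1 ∈ I.map C :=
  prod_one_sub_sub_one_mem a.support (x := fun i => monomial (i + 1) (a i)) fun i => by
    rw [← C_mul_X_pow_eq_monomial]
    exact Ideal.mul_mem_right _ _ (Ideal.mem_map_of_mem C (ha i))

theorem exists_span_pow_eq_bot {s : Set A} (hs : s.Finite) (h : ∀ x ∈ s, IsNilpotent x) :
    ∃ N, Ideal.span s ^ N = ⊥ :=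
  (Ideal.FG.isNilpotent_iff_le_nilradical (Submodule.fg_span hs)).2 (Ideal.span_le.2 h)

theorem exists_wittProdPoly_sub_mem {I : Ideal A} {p : A[X]} (hp₀ : p.coeff 0 = 1)
    (hp : p - 1 ∈ I.map C) (k : ℕ) :
    ∃ a : ℕ →₀ A, (∀ i, a i ∈ I) ∧ p - wittProdPoly a ∈ (I ^ (k + 1)).map C := by
  induction k with
  | zero => exact ⟨0, by simp, by simpa [wittProdPoly] using hp⟩
  | succ k ih =>
    obtain ⟨a, ha, hpa⟩ := ih
    obtain ⟨c, hc⟩ := exists_shiftedPoly_eq (q := p - wittProdPoly a)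
      (by simp [hp₀, coeff_wittProdPoly_zero])
    rw [← hc, shiftedPoly_mem_map_C] at hpa
    have hle : I ^ (k + 1) ≤ I := Ideal.pow_le_self k.succ_ne_zero
    refine ⟨a - c, fun i => I.sub_mem (ha i) (hle (hpa i)), ?_⟩
    have h := wittProdPoly_sub_expansion_mem hle ha hpa
    rw [hc, ← pow_succ', add_sub_cancel] at h
    rw [← neg_sub]
    exact neg_mem h

theorem sub_mem_pow_of_wittProdPoly_eq {I : Ideal A} {a a' : ℕ →₀ A} (ha : ∀ i, a i ∈ I)
    (ha' : ∀ i, a' i ∈ I) (h : wittProdPoly a = wittProdPoly a') (k : ℕ) :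
    ∀ i, (a - a') i ∈ I ^ (k + 1) := by
  induction k with
  | zero => simpa using fun i => I.sub_mem (ha i) (ha' i)
  | succ k ih =>
    have hexp := wittProdPoly_sub_expansion_mem (Ideal.pow_le_self k.succ_ne_zero) ha ih
    rw [sub_sub_cancel, h, ← pow_succ', sub_add_cancel_left] at hexp
    exact shiftedPoly_mem_map_C.1 (neg_mem_iff.1 hexp)

theorem isNilpotent_of_mem_of_pow_eq_bot {I : Ideal A} {N : ℕ} (hN : I ^ N = ⊥) {x : A}
    (hx : x ∈ I) : IsNilpotent x :=
  ⟨N, by simpa [hN] using Ideal.pow_mem_pow hx N⟩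

end

/-- Let `A` be a commutative ring, `N` the set of finitely supported
sequences of nilpotent elements of `A`, and `G` the set of Laurent series
`1 + Σ_{i=1}^m b_i z^{-i}` with nilpotent `b_i`.  The map `N → G` given by
`(a_i) ↦ Π_{i>0} (1 - a_i z^{-i})` is a bijection (it maps into `G`, is injective and is
surjective onto `G`). -/
theorem gammaMinus_wittProd_bijective {A : Type*} [CommRing A] :
    (∀ a : ℕ →₀ A, (∀ i, IsNilpotent (a i)) → IsGammaMinusElt (wittProdSeries a)) ∧
    (∀ a a' : ℕ →₀ A, (∀ i, IsNilpotent (a i)) → (∀ i, IsNilpotent (a' i)) →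
      wittProdSeries a = wittProdSeries a' → a = a') ∧
    (∀ f : LaurentSeries A, IsGammaMinusElt f →
      ∃ a : ℕ →₀ A, (∀ i, IsNilpotent (a i)) ∧ wittProdSeries a = f) := by
  refine ⟨fun a ha => ?_, fun a a' ha ha' h => ?_, ?_⟩
  · obtain ⟨N, hN⟩ := exists_span_pow_eq_bot a.finite_range (by rintro _ ⟨i, rfl⟩; exact ha i)
    have hmem := wittProdPoly_sub_one_mem fun i => Ideal.subset_span (Set.mem_range_self (f := a) i)
    obtain ⟨b, hb⟩ := exists_shiftedPoly_eq (q := wittProdPoly a - 1)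
      (by simp [coeff_wittProdPoly_zero])
    rw [← hb, shiftedPoly_mem_map_C] at hmem
    refine ⟨b, fun i => isNilpotent_of_mem_of_pow_eq_bot hN (hmem i), ?_⟩
    rw [← polyInvVar_shiftedPoly, hb, add_sub_cancel, polyInvVar_wittProdPoly]
  · obtain ⟨N, hN⟩ := exists_span_pow_eq_bot (a.finite_range.union a'.finite_range)
      (by rintro _ (⟨i, rfl⟩ | ⟨i, rfl⟩); exacts [ha i, ha' i])
    rw [← polyInvVar_wittProdPoly, ← polyInvVar_wittProdPoly] at h
    have hmem := sub_mem_pow_of_wittProdPoly_eq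
      (I := Ideal.span (Set.range a ∪ Set.range a'))
      (fun i => Ideal.subset_span (Or.inl (Set.mem_range_self i)))
      (fun i => Ideal.subset_span (Or.inr (Set.mem_range_self i))) (polyInvVar_injective h) N
    ext i
    rw [pow_succ, hN, Ideal.bot_mul] at hmem
    simpa [sub_eq_zero] using hmem i
  · rintro _ ⟨b, hb, rfl⟩
    obtain ⟨N, hN⟩ := exists_span_pow_eq_bot b.finite_range (by rintro _ ⟨i, rfl⟩; exact hb i)
    obtain ⟨a, ha, hmem⟩ := exists_wittProdPoly_sub_mem (p := 1 + shiftedPoly b)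
      (I := Ideal.span (Set.range b)) (by simp [coeff_shiftedPoly_zero])
      (by simpa using shiftedPoly_mem_map_C.2 fun i => Ideal.subset_span (Set.mem_range_self i)) N
    refine ⟨a, fun i => isNilpotent_of_mem_of_pow_eq_bot hN (ha i), ?_⟩
    rw [pow_succ, hN, Ideal.bot_mul, Ideal.map_bot, Ideal.mem_bot, sub_eq_zero] at hmem
    rw [← polyInvVar_wittProdPoly, ← hmem, polyInvVar_shiftedPoly]

end
end
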